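/- arXiv:0812.0444 — 2 statements merged into one kernel-verified Lean document; each statement's English description precedes it below -/
import Mathlib

section
/- Let ⋆ be a semistar operation on an integral domain D. If D is a ⋆̃-stably strong S-domain and ⋆̃-dim(D) is finite, then D is a ⋆̃-Jaffard domain, i.e., ⋆[n]-dim(D[X₁,…,Xₙ]) = ⋆̃-dim(D) + n for every n ≥ 1. -/
/- ## Preliminaries: general ideal-chain notions in a commutative ring -/

open Pointwise

section ChainNotions

variable {A B : Type*} [CommRing A] [CommRing B]

/-- `P` and `Q` are adjacent with respect to the class `Φ` of ideals:
`P ⊂ Q` and no ideal of the class `Φ` lies strictly between them. -/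
def AdjacentFor (Φ : Ideal A → Prop) (P Q : Ideal A) : Prop :=
  P < Q ∧ ∀ I : Ideal A, Φ I → ¬(P < I ∧ I < Q)

/-- A saturated chain, consisting of ideals of the class `Φ`, of length `m`
between `P` and `Q` (saturated: consecutive members are `Φ`-adjacent). -/
def SaturatedChainFor (Φ : Ideal A → Prop) (P Q : Ideal A) (m : ℕ) : Prop :=
  ∃ c : Fin (m + 1) → Ideal A, StrictMono c ∧ c 0 = P ∧ c (Fin.last m) = Q ∧
    (∀ i, Φ (c i)) ∧ ∀ i : Fin m, AdjacentFor Φ (c i.castSucc) (c i.succ)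

/-- Catenarity with respect to the class `Φ` of ideals: for every pair `P ⊂ Q` of
`Φ`-ideals, any two saturated chains of `Φ`-ideals between `P` and `Q` have the
same (finite) length. -/
def CatenaryFor (Φ : Ideal A → Prop) : Prop :=
  ∀ P Q : Ideal A, Φ P → Φ Q → P < Q →
    ∀ m₁ m₂ : ℕ, SaturatedChainFor Φ P Q m₁ → SaturatedChainFor Φ P Q m₂ → m₁ = m₂

/-- A chain `(0) = P₀ ⊂ P₁ ⊂ ⋯ ⊂ Pₙ` with all `Pᵢ`, `1 ≤ i ≤ n`, in the class `Φ`. -/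
def DimChainFor (Φ : Ideal A → Prop) (n : ℕ) : Prop :=
  ∃ c : Fin (n + 1) → Ideal A, StrictMono c ∧ c 0 = ⊥ ∧ ∀ i, i ≠ 0 → Φ (c i)

/-- The dimension associated to the class `Φ` of (quasi-prime) ideals: the supremum of
the lengths of chains `(0) = P₀ ⊂ P₁ ⊂ ⋯ ⊂ Pₙ` with all `Pᵢ` (`i ≥ 1`) in `Φ`. -/
noncomputable def quasiDim (Φ : Ideal A → Prop) : ℕ∞ :=
  ⨆ (n : ℕ) (_ : DimChainFor Φ n), (n : ℕ∞)

/-- The height of an ideal `P`: the supremum of lengths of strict chains of prime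
ideals ending at `P`. -/
noncomputable def idealHeight (P : Ideal A) : ℕ∞ :=
  ⨆ (n : ℕ) (_ : ∃ c : Fin (n + 1) → Ideal A, StrictMono c ∧ (∀ i, (c i).IsPrime) ∧
      c (Fin.last n) = P), (n : ℕ∞)

/-- The Krull dimension of a commutative ring, as the supremum in `ℕ∞` of the lengths
of strict chains of prime ideals. -/
noncomputable def krullDimE (A : Type*) [CommRing A] : ℕ∞ :=
  ⨆ (n : ℕ) (_ : ∃ c : Fin (n + 1) → Ideal A, StrictMono c ∧ ∀ i, (c i).IsPrime), (n : ℕ∞)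

/-- Every pair of `Φ`-adjacent `Φ`-ideals `P ⊂ Q` of `A` extends, along `f : A →+* B`,
to a pair of `Ψ`-adjacent `Ψ`-ideals `P.map f ⊂ Q.map f` of `B`. -/
def ExtendsAdjacent (f : A →+* B) (Φ : Ideal A → Prop) (Ψ : Ideal B → Prop) : Prop :=
  ∀ P Q : Ideal A, Φ P → Φ Q → AdjacentFor Φ P Q →
    Ψ (Ideal.map f P) ∧ Ψ (Ideal.map f Q) ∧ AdjacentFor Ψ (Ideal.map f P) (Ideal.map f Q)

/-- A (classically) catenary ring: any two saturated chains of primes between a fixed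
pair of primes `P ⊂ Q` have the same finite length. -/
def IsCatenaryRing (A : Type*) [CommRing A] : Prop :=
  CatenaryFor (fun I : Ideal A => I.IsPrime)

/-- A (classical) S-domain: every height-one prime `P` extends to a height-one prime
`P[X]` of the polynomial ring. -/
def IsSDomain (A : Type*) [CommRing A] : Prop :=
  ∀ P : Ideal A, P.IsPrime → idealHeight P = 1 →
    idealHeight (Ideal.map (Polynomial.C : A →+* Polynomial A) P) = 1

/-- A (classical) strong S-domain: every pair of adjacent primes `P ⊂ Q` extends to a
pair of adjacent primes `P[X] ⊂ Q[X]` of the polynomial ring. -/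
def IsStrongSDomain (A : Type*) [CommRing A] : Prop :=
  ExtendsAdjacent (Polynomial.C : A →+* Polynomial A)
    (fun I : Ideal A => I.IsPrime) (fun I : Ideal (Polynomial A) => I.IsPrime)

/-- A (classical) stably strong S-domain: `A[X₁,…,Xₙ]` is a strong S-domain for all `n ≥ 1`. -/
def IsStablyStrongSDomain (A : Type*) [CommRing A] : Prop :=
  ∀ n : ℕ, 1 ≤ n → IsStrongSDomain (MvPolynomial (Fin n) A)

/-- A (classical) Jaffard domain: finite Krull dimension, and
`dim (A[X₁,…,Xₙ]) = dim A + n` for all `n ≥ 1`. -/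
def IsJaffardDomain (A : Type*) [CommRing A] : Prop :=
  krullDimE A ≠ ⊤ ∧ ∀ n : ℕ, 1 ≤ n → krullDimE (MvPolynomial (Fin n) A) = krullDimE A + n

end ChainNotions

/- ## Semistar operations -/

section Semistar

variable (R : Type*) (F : Type*) [CommRing R] [Field F] [Algebra R F]

instance (priority := 100) : SMulCommClass F R F := SMulCommClass.symm R F F

/-- A semistar operation on a domain `R` with quotient field `F`: an operation on the
(nonzero) `R`-submodules of `F` satisfying `(xE)^⋆ = x E^⋆`, monotonicity, extensivity
and idempotency. (The value on the zero submodule is irrelevant.) -/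
structure SemistarOp where
  /-- the underlying map on `R`-submodules of `F` -/
  star : Submodule R F → Submodule R F
  star_smul : ∀ x : F, x ≠ 0 → ∀ E : Submodule R F, E ≠ ⊥ → star (x • E) = x • star E
  star_mono : ∀ E G : Submodule R F, E ≠ ⊥ → G ≠ ⊥ → E ≤ G → star E ≤ star G
  le_star : ∀ E : Submodule R F, E ≠ ⊥ → E ≤ star E
  star_idem : ∀ E : Submodule R F, E ≠ ⊥ → star (star E) = star E

variable {R F}

/-- The extension of an ideal of `R` to an `R`-submodule of `F`. -/
def idealExt (I : Ideal R) : Submodule R F := Submodule.map (Algebra.linearMap R F) I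

/-- The contraction to `R` of an `R`-submodule of `F` (i.e. `E ∩ R`). -/
def idealCon (E : Submodule R F) : Ideal R := Submodule.comap (Algebra.linearMap R F) E

/-- The finite-type semistar operation `⋆_f` associated to `⋆`:
`E^{⋆_f}` is the union of `G^⋆` over all nonzero finitely generated `G ⊆ E`
(the family is directed, so the union is the supremum). -/
noncomputable def SemistarOp.ft (s : SemistarOp R F) (E : Submodule R F) : Submodule R F :=
  ⨆ (G : Submodule R F) (_ : G.FG ∧ G ≠ ⊥ ∧ G ≤ E), s.star G

/-- `I` is a quasi-`f`-ideal (for `f` a semistar-type operation, e.g. `s.star`, `s.ft`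
or `s.tilde`): `I` is nonzero and `f(I) ∩ R = I`. -/
def IsQuasiIdeal (f : Submodule R F → Submodule R F) (I : Ideal R) : Prop :=
  I ≠ ⊥ ∧ idealCon (f (idealExt I)) = I

/-- A quasi-prime: a prime quasi-ideal. -/
def IsQuasiPrime (f : Submodule R F → Submodule R F) (I : Ideal R) : Prop :=
  I.IsPrime ∧ IsQuasiIdeal f I

/-- A quasi-maximal ideal: maximal among proper quasi-ideals. -/
def IsQuasiMax (f : Submodule R F → Submodule R F) (I : Ideal R) : Prop :=
  IsQuasiIdeal f I ∧ I ≠ ⊤ ∧ ∀ J : Ideal R, IsQuasiIdeal f J → J ≠ ⊤ → I ≤ J → I = J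

/-- The stable finite-type semistar operation `⋆̃` associated to `⋆`:
`E^{⋆̃} = ⋂ { E R_P : P a quasi-⋆_f-maximal ideal }`, where
`x ∈ E R_P ↔ ∃ d ∉ P, d • x ∈ E` (each quasi-⋆_f-maximal ideal is prime); if there
is no quasi-⋆_f-maximal ideal, `E^{⋆̃} = F`. -/
def SemistarOp.tilde (s : SemistarOp R F) (E : Submodule R F) : Submodule R F where
  carrier := {x : F | ∀ P : Ideal R, IsQuasiMax s.ft P → P.IsPrime →
    ∃ d : R, d ∉ P ∧ d • x ∈ E}
  zero_mem' := by
    intro P _ hP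
    exact ⟨1, fun h => hP.ne_top ((Ideal.eq_top_iff_one P).mpr h), by simp⟩
  add_mem' := by
    intro x y hx hy P hPmax hP
    obtain ⟨d₁, hd₁, hdx⟩ := hx P hPmax hP
    obtain ⟨d₂, hd₂, hdy⟩ := hy P hPmax hP
    refine ⟨d₁ * d₂, fun h => (hP.mem_or_mem h).elim hd₁ hd₂, ?_⟩
    have h₁ : (d₁ * d₂) • x ∈ E := by rw [mul_comm, mul_smul]; exact E.smul_mem d₂ hdx
    have h₂ : (d₁ * d₂) • y ∈ E := by rw [mul_smul]; exact E.smul_mem d₁ hdy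
    simpa [smul_add] using E.add_mem h₁ h₂
  smul_mem' := by
    intro r x hx P hPmax hP
    obtain ⟨d, hd, hdx⟩ := hx P hPmax hP
    refine ⟨d, hd, ?_⟩
    rw [smul_smul, mul_comm, ← smul_smul]
    exact E.smul_mem r hdx

/-- The characterization of the quasi-`⋆[n]`-prime ideals of `R[n] = R[X₁,…,Xₙ]` for the
iterated Nagata-type (stable, finite-type) semistar operation `⋆[n]` on `R[n]`:
a nonzero prime `Q` of `R[n]` is quasi-`⋆[n]`-prime iff `Q ∩ R = 0` or
`(Q ∩ R)^{⋆_f} ≠ R^⋆`. -/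
def QuasiPolyPrime (s : SemistarOp R F) (n : ℕ) (Q : Ideal (MvPolynomial (Fin n) R)) : Prop :=
  Q ≠ ⊥ ∧ Q.IsPrime ∧
    (Ideal.comap (algebraMap R (MvPolynomial (Fin n) R)) Q = ⊥ ∨
      s.ft (idealExt (Ideal.comap (algebraMap R (MvPolynomial (Fin n) R)) Q)) ≠
        s.star (idealExt (⊤ : Ideal R)))

/-- The `⋆̃`-dimension of `R`. -/
noncomputable def tildeDim (s : SemistarOp R F) : ℕ∞ := quasiDim (IsQuasiPrime s.tilde)

/-- The `⋆[n]`-dimension of `R[n] = R[X₁,…,Xₙ]`. -/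
noncomputable def polyDim (s : SemistarOp R F) (n : ℕ) : ℕ∞ := quasiDim (QuasiPolyPrime s n)

/-- `R` is a `⋆̃`-S-domain: every height-one quasi-`⋆̃`-prime `P` extends to a height-one
quasi-`⋆[1]`-prime `P[X₁]` of `R[X₁]`. -/
def TildeSDomain (s : SemistarOp R F) : Prop :=
  ∀ P : Ideal R, IsQuasiPrime s.tilde P → idealHeight P = 1 →
    QuasiPolyPrime s 1 (Ideal.map (algebraMap R (MvPolynomial (Fin 1) R)) P) ∧
    idealHeight (Ideal.map (algebraMap R (MvPolynomial (Fin 1) R)) P) = 1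

/-- `R` is a `⋆̃`-strong S-domain: each pair of adjacent quasi-`⋆̃`-primes `P₁ ⊂ P₂`
extends to a pair of adjacent quasi-`⋆[1]`-primes `P₁[X₁] ⊂ P₂[X₁]` of `R[X₁]`. -/
def TildeStrongSDomain (s : SemistarOp R F) : Prop :=
  ExtendsAdjacent (algebraMap R (MvPolynomial (Fin 1) R))
    (IsQuasiPrime s.tilde) (QuasiPolyPrime s 1)

/-- `R[n]` is a `⋆[n]`-strong S-domain: each pair of adjacent quasi-`⋆[n]`-primes
`Q₁ ⊂ Q₂` of `R[n]` extends to a pair of adjacent quasi-`⋆[n+1]`-primes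
`Q₁[X_{n+1}] ⊂ Q₂[X_{n+1}]` of `R[n+1]`. -/
def PolyStrongSDomain (s : SemistarOp R F) (n : ℕ) : Prop :=
  ExtendsAdjacent (MvPolynomial.rename (Fin.castSucc : Fin n → Fin (n + 1))).toRingHom
    (QuasiPolyPrime s n) (QuasiPolyPrime s (n + 1))

/-- `R` is a `⋆̃`-stably strong S-domain: `R[n]` is a `⋆[n]`-strong S-domain for all
`n ≥ 1`. -/
def TildeStablyStrongSDomain (s : SemistarOp R F) : Prop :=
  ∀ n : ℕ, 1 ≤ n → PolyStrongSDomain s n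

/-- `R` is `⋆̃`-catenary. -/
def TildeCatenary (s : SemistarOp R F) : Prop := CatenaryFor (IsQuasiPrime s.tilde)

/-- `R[n]` is `⋆[n]`-catenary. -/
def PolyCatenary (s : SemistarOp R F) (n : ℕ) : Prop := CatenaryFor (QuasiPolyPrime s n)

/-- `R` is `⋆̃`-universally catenarian: `R[n]` is `⋆[n]`-catenary for all `n ≥ 1`. -/
def TildeUnivCatenarian (s : SemistarOp R F) : Prop :=
  ∀ n : ℕ, 1 ≤ n → PolyCatenary s n

/-- `R` is a `⋆̃`-Jaffard domain. -/
def TildeJaffard (s : SemistarOp R F) : Prop :=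
  tildeDim s ≠ ⊤ ∧ ∀ n : ℕ, 1 ≤ n → polyDim s n = tildeDim s + n

/-- `R` is `⋆̃`-Noetherian: ascending chain condition on quasi-`⋆̃`-ideals. -/
def TildeNoetherian (s : SemistarOp R F) : Prop :=
  ∀ f : ℕ → Ideal R, (∀ i, IsQuasiIdeal s.tilde (f i)) → Monotone f →
    ∃ N : ℕ, ∀ m : ℕ, N ≤ m → f m = f N

/-- `R` is a `⋆̃`-quasi-Prüfer domain: every prime `Q` of `R[X]` with `Q ⊆ P[X]` for some
quasi-`⋆̃`-prime `P` of `R` satisfies `Q = (Q ∩ R)[X]`. -/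
def TildeQuasiPrufer (s : SemistarOp R F) : Prop :=
  ∀ Q : Ideal (Polynomial R), Q.IsPrime →
    (∃ P : Ideal R, IsQuasiPrime s.tilde P ∧
      Q ≤ Ideal.map (Polynomial.C : R →+* Polynomial R) P) →
    Q = Ideal.map (Polynomial.C : R →+* Polynomial R)
      (Ideal.comap (Polynomial.C : R →+* Polynomial R) Q)

/-- `R` is a Prüfer `⋆`-multiplication domain: `(I · (R :_F I))^{⋆_f} = R^⋆` for every
nonzero finitely generated ideal `I` of `R`. -/
def IsPStarMD (s : SemistarOp R F) : Prop :=
  ∀ I : Ideal R, I ≠ ⊥ → I.FG →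
    s.ft (idealExt I * ((idealExt (⊤ : Ideal R) : Submodule R F) / idealExt I)) =
      s.star (idealExt (⊤ : Ideal R))

/-- An overring `T` of `R` (with semistar operation `⋆'`) is `(⋆,⋆')`-linked to `R`:
for every nonzero finitely generated ideal `G` of `R`, `G^⋆ = R^⋆` implies
`(GT)^{⋆'} = T^{⋆'}`. -/
def IsLinkedOverring (s : SemistarOp R F) (T : Subalgebra R F) (s' : SemistarOp T F) : Prop :=
  ∀ G : Ideal R, G ≠ ⊥ → G.FG →
    s.star (idealExt G) = s.star (idealExt (⊤ : Ideal R)) →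
      s'.star (idealExt (Ideal.map (algebraMap R T) G)) =
        s'.star (idealExt (⊤ : Ideal T))

/-- `R` is a `⋆̃`-going-down domain: for every overring `T` of `R` (a subring of `F`
containing `R`; note `F` is also the quotient field of `T`) and every semistar operation
`⋆'` on `T`, the extension `R ⊆ T` satisfies `(⋆̃,⋆̃')`-GD. -/
def TildeGoingDown (s : SemistarOp R F) : Prop :=
  ∀ (T : Subalgebra R F) (s' : SemistarOp T F),
    ∀ P₀ P : Ideal R, IsQuasiPrime s.tilde P₀ → IsQuasiPrime s.tilde P → P₀ < P →
      ∀ Q : Ideal T, IsQuasiPrime s'.tilde Q → Ideal.comap (algebraMap R T) Q = P →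
        ∃ Q₀ : Ideal T, IsQuasiPrime s'.tilde Q₀ ∧ Q₀ ≤ Q ∧
          Ideal.comap (algebraMap R T) Q₀ = P₀

end Semistar

section PolynomialChains

open Order

/-- The supremum of the heights of the elements of a set. -/
noncomputable def heightSup {α : Type*} [Preorder α] (T : Set α) : ℕ∞ := ⨆ p ∈ T, height p

theorem heightSup_preimage {α β : Type*} [Preorder α] [Preorder β] (e : α ≃o β) (T : Set β) :
    heightSup (e ⁻¹' T) = heightSup T := by
  rw [show e ⁻¹' T = e.symm '' T from (e.symm.toEquiv.image_eq_preimage_symm T).symm]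
  simp only [heightSup, iSup_image, height_orderIso]

namespace PrimeSpectrum

variable {A : Type*} [CommRing A]

/-- The extension `p[X]` of a prime `p` to the polynomial ring. -/
noncomputable def polyExt (p : PrimeSpectrum A) : PrimeSpectrum (Polynomial A) :=
  ⟨p.asIdeal.map Polynomial.C, inferInstance⟩

@[simp]
theorem comap_C_polyExt (p : PrimeSpectrum A) : comap Polynomial.C (polyExt p) = p := by
  ext a
  simp [polyExt, Ideal.mem_map_C_iff, Polynomial.coeff_C, apply_ite]

theorem polyExt_le_iff (p : PrimeSpectrum A) (q : PrimeSpectrum (Polynomial A)) :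
    polyExt p ≤ q ↔ p ≤ comap Polynomial.C q :=
  Ideal.map_le_iff_le_comap

theorem polyExt_strictMono : StrictMono (polyExt (A := A)) := by
  refine Monotone.strictMono_of_injective (fun p q h => ?_)
    (Function.LeftInverse.injective comap_C_polyExt)
  simpa [polyExt_le_iff] using h

/-- Prime ideals of `A[X]` with the same contraction to `A` form no chain of three. -/
theorem not_lt_lt_of_comap_C_eq {q₁ q₂ q₃ : PrimeSpectrum (Polynomial A)} {p : PrimeSpectrum A}
    (h₁ : comap Polynomial.C q₁ = p) (h₂ : comap Polynomial.C q₂ = p)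
    (h₃ : comap Polynomial.C q₃ = p) (h₁₂ : q₁ < q₂) : ¬ q₂ < q₃ := by
  intro h₂₃
  have hdim : krullDim (comap (Polynomial.C : A →+* Polynomial A) ⁻¹' {p}) ≤ 1 := by
    rw [show (Polynomial.C : A →+* Polynomial A) = algebraMap A (Polynomial A) from rfl,
      krullDim_eq_of_orderIso (preimageOrderIsoFiber A (Polynomial A) p), ← ringKrullDim,
      ← ringKrullDim_eq_of_ringEquiv (polyEquivTensor A (p.asIdeal.ResidueField)).toRingEquiv]
    exact_mod_cast (Ring.krullDimLE_iff (n := 1)).1 inferInstance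
  let c : LTSeries (comap (Polynomial.C : A →+* Polynomial A) ⁻¹' {p}) :=
    ⟨2, ![⟨q₁, h₁⟩, ⟨q₂, h₂⟩, ⟨q₃, h₃⟩], fun i => by fin_cases i <;> assumption⟩
  have := c.length_le_krullDim.trans hdim
  norm_cast at this

/-- A set of primes such that adjacent pairs below its members extend to adjacent pairs in the
polynomial ring. -/
def StrongOn (T : Set (PrimeSpectrum A)) : Prop :=
  ∀ p, ∀ q ∈ T, p ⋖ q → polyExt p ⋖ polyExt q

theorem height_le_of_strongOn {T : Set (PrimeSpectrum A)} (hT : IsLowerSet T) (hS : StrongOn T)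
    (n : ℕ) : ∀ p ∈ T, height p ≤ n → height (polyExt p) ≤ n ∧
      ∀ q, comap Polynomial.C q = p → height q ≤ n + 1 := by
  induction n using Nat.strong_induction_on with
  | h n ih =>
    intro p hpT hp
    have below : ∀ p' < p, ∃ m < n, height p' = m ∧ height (polyExt p') ≤ m ∧
        ∀ q, comap Polynomial.C q = p' → height q ≤ m + 1 := by
      intro p' hp'
      have hlt := height_le_coe_iff.1 hp p' hp'
      obtain ⟨m, hm⟩ := ENat.ne_top_iff_exists.1 (ne_top_of_lt hlt)
      rw [← hm] at hlt
      have hmn : m < n := by exact_mod_cast hlt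
      exact ⟨m, hmn, hm.symm, ih m hmn p' (hT hp'.le hpT) hm.ge⟩
    have hext : height (polyExt p) ≤ n := by
      refine height_le_coe_iff.2 fun q hq => ?_
      have hle : comap Polynomial.C q ≤ p := by
        simpa using (show comap Polynomial.C q ≤ comap Polynomial.C (polyExt p) from
          Ideal.comap_mono hq.le)
      have hlt : comap Polynomial.C q < p := by
        refine hle.lt_of_ne fun h => hq.not_ge ?_
        rw [polyExt_le_iff, h]
      obtain ⟨m, hmn, hm, hm₁, hm₂⟩ := below _ hlt
      rcases ((polyExt_le_iff _ q).2 le_rfl).eq_or_lt with h | h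
      · rw [h] at hm₁
        exact hm₁.trans_lt (by exact_mod_cast hmn)
      · have hnot : ¬ comap Polynomial.C q ⋖ p := fun hcov => (hS _ p hpT hcov).2 h hq
        obtain ⟨r, hr₁, hr₂⟩ := (not_covBy_iff hlt).1 hnot
        obtain ⟨k, hkn, hk, -⟩ := below r hr₂
        have h1 := height_add_one_le hr₁
        rw [hm, hk] at h1
        have h2 : m + 1 ≤ k := by exact_mod_cast h1
        refine (hm₂ q rfl).trans_lt ?_
        exact_mod_cast h2.trans_lt hkn
    refine ⟨hext, fun q hq => ?_⟩
    have hn1 : ((n : ℕ∞) + 1) = ((n + 1 : ℕ) : ℕ∞) := by push_cast; rfl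
    rw [hn1]
    refine height_le_coe_iff.2 fun q' hq' => ?_
    have hle : comap Polynomial.C q' ≤ p := by
      rw [← hq]
      exact Ideal.comap_mono hq'.le
    rcases hle.eq_or_lt with h | h
    · have hq'' : polyExt p = q' := by
        by_contra hne
        exact not_lt_lt_of_comap_C_eq (comap_C_polyExt p) h hq
          (((polyExt_le_iff p q').2 h.ge).lt_of_ne hne) hq'
      rw [← hq'']
      exact hext.trans_lt (by exact_mod_cast n.lt_succ_self)
    · obtain ⟨m, hmn, -, -, hm₂⟩ := below _ h
      refine (hm₂ q' rfl).trans_lt ?_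
      exact_mod_cast Nat.succ_lt_succ hmn

/-- The prime ideal `(p, X)` of `A[X]`. -/
noncomputable def polyZero (p : PrimeSpectrum A) : PrimeSpectrum (Polynomial A) :=
  comap (Polynomial.constantCoeff (R := A)) p

theorem comap_C_polyZero (p : PrimeSpectrum A) : comap Polynomial.C (polyZero p) = p := by
  ext a
  simp [polyZero]

theorem polyExt_lt_polyZero (p : PrimeSpectrum A) : polyExt p < polyZero p := by
  refine ((polyExt_le_iff _ _).2 (comap_C_polyZero p).ge).lt_of_ne fun h => ?_
  have hX : (Polynomial.X : Polynomial A) ∈ (polyZero p).asIdeal := by simp [polyZero]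
  rw [← h] at hX
  refine p.2.ne_top ((Ideal.eq_top_iff_one _).2 ?_)
  simpa using Ideal.mem_map_C_iff.1 hX 1

theorem heightSup_comap_C {T : Set (PrimeSpectrum A)} (hT : IsLowerSet T) (hS : StrongOn T)
    (hne : T.Nonempty) :
    heightSup (comap (Polynomial.C : A →+* Polynomial A) ⁻¹' T) = heightSup T + 1 := by
  apply le_antisymm
  · refine iSup₂_le fun q hq => ?_
    rcases eq_or_ne (height (comap Polynomial.C q)) ⊤ with h | h
    · have : heightSup T = ⊤ := top_unique (h ▸ le_iSup₂_of_le _ hq le_rfl)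
      simp [this]
    · obtain ⟨m, hm⟩ := ENat.ne_top_iff_exists.1 h
      refine ((height_le_of_strongOn hT hS m _ hq hm.ge).2 q rfl).trans ?_
      rw [hm]
      gcongr
      exact le_iSup₂_of_le _ hq le_rfl
  · have := hne.to_subtype
    rw [heightSup, iSup_subtype', ENat.iSup_add]
    refine iSup_le fun p => ?_
    have hp : polyZero p.1 ∈ comap (Polynomial.C : A →+* Polynomial A) ⁻¹' T := by
      rw [Set.mem_preimage, comap_C_polyZero]
      exact p.2
    refine le_iSup₂_of_le _ hp (le_trans ?_ (height_add_one_le (polyExt_lt_polyZero p.1)))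
    gcongr
    exact height_le_height_apply_of_strictMono _ polyExt_strictMono _

/-- Strongness passes along a surjection `B → A`, tested on the primes pulled back to `B`. -/
theorem StrongOn.of_surjective {B : Type*} [CommRing B] {φ : B →+* A}
    (hφ : Function.Surjective φ) {T : Set (PrimeSpectrum A)}
    (h : ∀ p, ∀ q ∈ T, comap φ p ⋖ comap φ q →
      polyExt (comap φ p) ⋖ polyExt (comap φ q)) : StrongOn T := by
  intro p q hq hpq
  have hcomap {S S' : Type _} [CommRing S] [CommRing S'] {f : S →+* S'}
      (hf : Function.Surjective f) (a b : PrimeSpectrum S') : comap f a < comap f b ↔ a < b :=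
    lt_iff_lt_of_le_iff_le' (Ideal.comap_le_comap_iff_of_surjective _ hf _ _)
      (Ideal.comap_le_comap_iff_of_surjective _ hf _ _)
  have hcov : comap φ p ⋖ comap φ q := by
    refine ⟨(hcomap hφ _ _).2 hpq.1, fun r hr₁ hr₂ => ?_⟩
    obtain ⟨t, rfl⟩ : r ∈ Set.range (comap φ) :=
      (range_comap_of_surjective _ _ hφ).ge ((Ideal.ker_le_comap _).trans hr₁.le)
    exact hpq.2 ((hcomap hφ _ _).1 hr₁) ((hcomap hφ _ _).1 hr₂)
  have hψ : Function.Surjective (Polynomial.mapRingHom φ) := Polynomial.map_surjective φ hφ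
  have hext (a : PrimeSpectrum A) :
      comap (Polynomial.mapRingHom φ) (polyExt a) = polyExt (comap φ a) := by
    ext f
    simp [polyExt, Ideal.mem_map_C_iff]
  refine ⟨polyExt_strictMono hpq.1, fun r hr₁ hr₂ => ?_⟩
  rw [← hcomap hψ, hext] at hr₁ hr₂
  exact (h p q hq hcov).2 hr₁ hr₂

end PrimeSpectrum

end PolynomialChains

section QuasiPrimes

variable {R F : Type*} [CommRing R] [Field F] [Algebra R F]

theorem idealExt_mono {I J : Ideal R} (h : I ≤ J) :
    (idealExt I : Submodule R F) ≤ idealExt J :=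
  Submodule.map_mono h

namespace SemistarOp

variable (s : SemistarOp R F)

theorem mem_ft {E : Submodule R F} (hE : E ≠ ⊥) {x : F} :
    x ∈ s.ft E ↔ ∃ G : Submodule R F, G.FG ∧ G ≠ ⊥ ∧ G ≤ E ∧ x ∈ s.star G := by
  obtain ⟨e, he, he0⟩ := Submodule.exists_mem_ne_zero_of_ne_bot hE
  rw [ft, iSup_subtype']
  have : Nonempty {G : Submodule R F // G.FG ∧ G ≠ ⊥ ∧ G ≤ E} :=
    ⟨⟨Submodule.span R {e}, Submodule.fg_span_singleton e, by simpa using he0, by simpa using he⟩⟩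
  rw [Submodule.mem_iSup_of_directed]
  · constructor
    · rintro ⟨⟨G, h₁, h₂, h₃⟩, h⟩
      exact ⟨G, h₁, h₂, h₃, h⟩
    · rintro ⟨G, h₁, h₂, h₃, h⟩
      exact ⟨⟨G, h₁, h₂, h₃⟩, h⟩
  · rintro ⟨G, h₁, h₂, h₃⟩ ⟨H, k₁, k₂, k₃⟩
    have hne : G ⊔ H ≠ ⊥ := fun h => h₂ (le_bot_iff.1 (le_sup_left.trans h.le))
    exact ⟨⟨G ⊔ H, h₁.sup k₁, hne, sup_le h₃ k₃⟩, s.star_mono _ _ h₂ hne le_sup_left,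
      s.star_mono _ _ k₂ hne le_sup_right⟩

theorem ft_mono {E E' : Submodule R F} (h : E ≤ E') : s.ft E ≤ s.ft E' :=
  iSup₂_le fun G hG => le_iSup₂_of_le G ⟨hG.1, hG.2.1, hG.2.2.trans h⟩ le_rfl

theorem le_ft {E : Submodule R F} (hE : E ≠ ⊥) : E ≤ s.ft E := by
  intro x hx
  rcases eq_or_ne x 0 with rfl | h0
  · exact zero_mem _
  · have hne : Submodule.span R {x} ≠ ⊥ := by simpa using h0
    exact (s.mem_ft hE).2 ⟨_, Submodule.fg_span_singleton x, hne, by simpa using hx,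
      s.le_star _ hne (Submodule.mem_span_singleton_self x)⟩

theorem exists_fg_le_star {E : Submodule R F} (hE : E ≠ ⊥) {G : Submodule R F} (hG : G.FG)
    (hle : G ≤ s.ft E) : ∃ H : Submodule R F, H.FG ∧ H ≠ ⊥ ∧ H ≤ E ∧ G ≤ s.star H := by
  induction G, hG using Submodule.fg_induction with
  | singleton x =>
    obtain ⟨H, h₁, h₂, h₃, h₄⟩ := (s.mem_ft hE).1 (hle (Submodule.mem_span_singleton_self x))
    exact ⟨H, h₁, h₂, h₃, by simpa using h₄⟩
  | sup G₁ G₂ hfg₁ hfg₂ ih₁ ih₂ =>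
    obtain ⟨H, h₁, h₂, h₃, h₄⟩ := ih₁ (le_sup_left.trans hle)
    obtain ⟨K, k₁, k₂, k₃, k₄⟩ := ih₂ (le_sup_right.trans hle)
    have hne : H ⊔ K ≠ ⊥ := fun h => h₂ (le_bot_iff.1 (le_sup_left.trans h.le))
    exact ⟨H ⊔ K, h₁.sup k₁, hne, sup_le h₃ k₃,
      sup_le (h₄.trans (s.star_mono _ _ h₂ hne le_sup_left))
        (k₄.trans (s.star_mono _ _ k₂ hne le_sup_right))⟩

theorem ft_ft_le {E : Submodule R F} (hE : E ≠ ⊥) : s.ft (s.ft E) ≤ s.ft E := by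
  refine iSup₂_le fun G hG => ?_
  obtain ⟨H, h₁, h₂, h₃, h₄⟩ := s.exists_fg_le_star hE hG.1 hG.2.2
  have hne : s.star H ≠ ⊥ := fun h => h₂ (le_bot_iff.1 ((s.le_star H h₂).trans h.le))
  refine (s.star_mono _ _ hG.2.1 hne h₄).trans ?_
  rw [s.star_idem H h₂]
  exact le_iSup₂_of_le H ⟨h₁, h₂, h₃⟩ le_rfl

end SemistarOp

variable [IsFractionRing R F]

theorem idealExt_ne_bot {I : Ideal R} (h : I ≠ ⊥) : (idealExt I : Submodule R F) ≠ ⊥ := by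
  intro h0
  exact h (Submodule.map_injective_of_injective (f := Algebra.linearMap R F)
    (IsFractionRing.injective R F) (h0.trans (Submodule.map_bot _).symm))

theorem mem_idealExt {I : Ideal R} {r : R} :
    algebraMap R F r ∈ (idealExt I : Submodule R F) ↔ r ∈ I := by
  constructor
  · rintro ⟨a, ha, h⟩
    rwa [← IsFractionRing.injective R F h]
  · exact fun h => ⟨r, h, rfl⟩

namespace SemistarOp

variable (s : SemistarOp R F)

theorem ft_idealExt_eq_iff [Nontrivial R] {I : Ideal R} (hI : I ≠ ⊥) :
    s.ft (idealExt I) = s.star (idealExt (⊤ : Ideal R)) ↔ (1 : F) ∈ s.ft (idealExt I) := by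
  have htop : (idealExt (⊤ : Ideal R) : Submodule R F) ≠ ⊥ := idealExt_ne_bot top_ne_bot
  constructor
  · intro h
    rw [h]
    exact s.le_star _ htop ⟨1, trivial, by simp⟩
  · intro h
    apply le_antisymm
    · exact iSup₂_le fun G hG =>
        s.star_mono _ _ hG.2.1 htop (hG.2.2.trans (idealExt_mono le_top))
    · obtain ⟨G, h₁, h₂, h₃, h₄⟩ := (s.mem_ft (idealExt_ne_bot hI)).1 h
      have hle : (idealExt (⊤ : Ideal R) : Submodule R F) ≤ s.star G := by
        rintro _ ⟨r, -, rfl⟩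
        simpa [Algebra.smul_def] using (s.star G).smul_mem r h₄
      have hne : s.star G ≠ ⊥ := fun h => h₂ (le_bot_iff.1 ((s.le_star G h₂).trans h.le))
      refine (s.star_mono _ _ htop hne hle).trans ?_
      rw [s.star_idem G h₂]
      exact le_iSup₂_of_le G ⟨h₁, h₂, h₃⟩ le_rfl

theorem exists_maximal_one_notMem_ft {I : Ideal R} (hI : I ≠ ⊥)
    (h1 : (1 : F) ∉ s.ft (idealExt I)) :
    ∃ M : Ideal R, I ≤ M ∧
      Maximal (fun J : Ideal R => (1 : F) ∉ s.ft (idealExt J)) M := by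
  have hbot : I ∈ {J : Ideal R | I ≤ J ∧ (1 : F) ∉ s.ft (idealExt J)} := ⟨le_rfl, h1⟩
  obtain ⟨M, hIM, hM⟩ := zorn_le_nonempty₀ {J : Ideal R | I ≤ J ∧ (1 : F) ∉ s.ft (idealExt J)}
    (fun c hc hchain y hy => by
      have hne : c.Nonempty := ⟨y, hy⟩
      have hIle : I ≤ sSup c := (hc hy).1.trans (le_sSup hy)
      refine ⟨sSup c, ⟨hIle, fun h => ?_⟩, fun z hz => le_sSup hz⟩
      obtain ⟨G, h₁, h₂, h₃, h₄⟩ :=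
        (s.mem_ft (idealExt_ne_bot (ne_bot_of_le_ne_bot hI hIle))).1 h
      have hdir : DirectedOn (· ≤ ·) c := hchain.directedOn
      have key : ∃ J ∈ c, G ≤ idealExt J := by
        clear h₂ h₄
        induction G, h₁ using Submodule.fg_induction with
        | singleton x =>
          obtain ⟨a, ha, rfl⟩ := h₃ (Submodule.mem_span_singleton_self x)
          obtain ⟨J, hJ, haJ⟩ := (Submodule.mem_sSup_of_directed hne hdir).1 ha
          exact ⟨J, hJ, by simpa using ⟨a, haJ, rfl⟩⟩
        | sup G₁ G₂ hfg₁ hfg₂ ih₁ ih₂ =>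
          obtain ⟨J₁, hJ₁, hle₁⟩ := ih₁ (le_sup_left.trans h₃)
          obtain ⟨J₂, hJ₂, hle₂⟩ := ih₂ (le_sup_right.trans h₃)
          obtain ⟨J, hJ, hl₁, hl₂⟩ := hdir J₁ hJ₁ J₂ hJ₂
          exact ⟨J, hJ, sup_le (hle₁.trans (idealExt_mono hl₁)) (hle₂.trans (idealExt_mono hl₂))⟩
      obtain ⟨J, hJ, hle⟩ := key
      exact (hc hJ).2 ((s.mem_ft (idealExt_ne_bot (ne_bot_of_le_ne_bot hI (hc hJ).1))).2
        ⟨G, h₁, h₂, hle, h₄⟩)) I hbot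
  exact ⟨M, hIM, hM.1.2, fun J hJ hMJ => hM.2 ⟨hIM.trans hMJ, hJ⟩ hMJ⟩

variable {s}

theorem idealCon_ft_eq_of_maximal {M : Ideal R} (hM0 : M ≠ ⊥)
    (hM : Maximal (fun J : Ideal R => (1 : F) ∉ s.ft (idealExt J)) M) :
    idealCon (s.ft (idealExt M)) = M := by
  have hle : M ≤ idealCon (s.ft (idealExt M)) := fun r hr =>
    s.le_ft (idealExt_ne_bot hM0) (mem_idealExt.2 hr)
  refine le_antisymm (hM.2 (fun h => hM.1 ?_) hle) hle
  refine s.ft_ft_le (idealExt_ne_bot hM0) (s.ft_mono ?_ h)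
  rintro _ ⟨r, hr, rfl⟩
  exact hr

theorem isQuasiMax_of_maximal {M : Ideal R} (hM0 : M ≠ ⊥)
    (hM : Maximal (fun J : Ideal R => (1 : F) ∉ s.ft (idealExt J)) M) :
    IsQuasiMax s.ft M := by
  refine ⟨⟨hM0, idealCon_ft_eq_of_maximal hM0 hM⟩, ?_, fun J hJ hJtop hle => ?_⟩
  · rintro rfl
    exact hM.1 (s.le_ft (idealExt_ne_bot hM0) ⟨1, trivial, by simp⟩)
  · refine le_antisymm hle (hM.2 (fun h => hJtop ?_) hle)
    rw [Ideal.eq_top_iff_one, ← hJ.2]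
    simpa [idealCon] using h

theorem isPrime_of_maximal {M : Ideal R} (hM0 : M ≠ ⊥)
    (hM : Maximal (fun J : Ideal R => (1 : F) ∉ s.ft (idealExt J)) M) : M.IsPrime := by
  refine ⟨(isQuasiMax_of_maximal hM0 hM).2.1, fun {a b} hab => ?_⟩
  by_contra! hcon
  obtain ⟨ha, hb⟩ := hcon
  have hb0 : algebraMap R F b ≠ 0 := by
    rw [Ne, IsFractionRing.to_map_eq_zero_iff]
    rintro rfl
    exact hb M.zero_mem
  have hlt : M < M ⊔ Ideal.span {a} :=
    left_lt_sup.2 fun h => ha (h (Ideal.mem_span_singleton_self a))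
  have h1 : (1 : F) ∈ s.ft (idealExt (M ⊔ Ideal.span {a})) := by
    by_contra h
    exact hlt.not_ge (hM.2 h hlt.le)
  obtain ⟨G, h₁, h₂, h₃, h₄⟩ :=
    (s.mem_ft (idealExt_ne_bot (ne_bot_of_le_ne_bot hM0 hlt.le))).1 h1
  apply hb
  rw [← idealCon_ft_eq_of_maximal hM0 hM]
  refine (s.mem_ft (idealExt_ne_bot hM0)).2 ⟨algebraMap R F b • G, h₁.map _, ?_, ?_, ?_⟩
  · obtain ⟨g, hg, hg0⟩ := Submodule.exists_mem_ne_zero_of_ne_bot h₂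
    intro h
    have := Submodule.smul_mem_pointwise_smul g (algebraMap R F b) G hg
    rw [h, Submodule.mem_bot] at this
    exact (smul_ne_zero hb0 hg0) this
  · rintro _ ⟨g, hg, rfl⟩
    obtain ⟨r, hr, rfl⟩ := h₃ hg
    obtain ⟨m, hm, t, ht, rfl⟩ := Submodule.mem_sup.1 hr
    obtain ⟨u, rfl⟩ := Ideal.mem_span_singleton.1 ht
    refine ⟨b * (m + a * u), ?_, by simp⟩
    have : b * (m + a * u) = b * m + u * (a * b) := by ring
    rw [this]
    exact M.add_mem (M.mul_mem_left b hm) (M.mul_mem_left u hab)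
  · rw [s.star_smul _ hb0 G h₂]
    simpa using Submodule.smul_mem_pointwise_smul 1 (algebraMap R F b) _ h₄

variable (s)

/-- The quasi-`⋆̃`-primes are the nonzero primes whose `⋆_f`-closure is proper. -/
theorem isQuasiPrime_tilde_iff [Nontrivial R] {P : Ideal R} :
    IsQuasiPrime s.tilde P ↔ P ≠ ⊥ ∧ P.IsPrime ∧
      s.ft (idealExt P) ≠ s.star (idealExt (⊤ : Ideal R)) := by
  constructor
  · rintro ⟨hP, hP0, hPq⟩
    refine ⟨hP0, hP, fun h => hP.ne_top ?_⟩
    rw [s.ft_idealExt_eq_iff hP0] at h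
    rw [Ideal.eq_top_iff_one, ← hPq]
    intro M hM hMp
    by_contra! hcon
    have hPM : P ≤ M := by
      intro r hr
      by_contra hrM
      refine hcon r hrM ?_
      simpa [Algebra.smul_def] using mem_idealExt.2 hr
    refine hM.2.1 ((Ideal.eq_top_iff_one M).2 ?_)
    rw [← hM.1.2]
    simpa [idealCon] using s.ft_mono (idealExt_mono hPM) h
  · rintro ⟨hP0, hP, h⟩
    rw [Ne, s.ft_idealExt_eq_iff hP0] at h
    obtain ⟨M, hPM, hM⟩ := s.exists_maximal_one_notMem_ft hP0 h
    have hM0 : M ≠ ⊥ := ne_bot_of_le_ne_bot hP0 hPM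
    refine ⟨hP, hP0, le_antisymm (fun x hx => ?_) (fun x hx => ?_)⟩
    · obtain ⟨d, hd, hdx⟩ := hx M (isQuasiMax_of_maximal hM0 hM) (isPrime_of_maximal hM0 hM)
      have hdx' : d * x ∈ P := by
        rw [← mem_idealExt (F := F)]
        simpa [Algebra.smul_def] using hdx
      exact (hP.mem_or_mem hdx').resolve_left fun h' => hd (hPM h')
    · intro N _ hN
      exact ⟨1, fun h' => hN.ne_top ((Ideal.eq_top_iff_one N).2 h'),
        by simpa using mem_idealExt.2 hx⟩

end SemistarOp

end QuasiPrimes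

namespace MvPolynomial

variable {R : Type*} [CommRing R] {n : ℕ}

variable (R n) in
/-- `R[X₁,…,Xₙ₊₁]` as polynomials in `Xₙ₊₁` over `R[X₁,…,Xₙ]`. -/
noncomputable def finSuccLastEquiv :
    MvPolynomial (Fin (n + 1)) R ≃ₐ[R] Polynomial (MvPolynomial (Fin n) R) :=
  (renameEquiv R finSuccEquivLast).trans (optionEquivLeft R (Fin n))

theorem finSuccLastEquiv_rename_castSucc (f : MvPolynomial (Fin n) R) :
    finSuccLastEquiv R n (rename Fin.castSucc f) = Polynomial.C f := by
  induction f using induction_on with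
  | C a => simp [finSuccLastEquiv, optionEquivLeft_C]
  | add p q hp hq => rw [map_add, map_add, hp, hq, map_add]
  | mul_X p i hp =>
    rw [map_mul, map_mul, hp, map_mul]
    simp [finSuccLastEquiv, optionEquivLeft_X_some]

theorem map_rename_castSucc (I : Ideal (MvPolynomial (Fin n) R)) :
    I.map (rename Fin.castSucc).toRingHom =
      (I.map Polynomial.C).comap (finSuccLastEquiv R n).toRingEquiv.toRingHom := by
  have h : (Polynomial.C : _ →+* Polynomial (MvPolynomial (Fin n) R)) =
      (finSuccLastEquiv R n).toRingEquiv.toRingHom.comp (rename Fin.castSucc).toRingHom :=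
    RingHom.ext fun f => (finSuccLastEquiv_rename_castSucc f).symm
  rw [h, ← Ideal.map_map]
  exact (Ideal.comap_map_of_bijective _ (finSuccLastEquiv R n).bijective).symm

end MvPolynomial

section Dimension

open PrimeSpectrum

theorem quasiDim_eq_heightSup {A : Type*} [CommRing A] [IsDomain A] {Φ : Ideal A → Prop}
    {T : Set (PrimeSpectrum A)} (hT : IsLowerSet T) (hbot : ⊥ ∈ T)
    (hΦ : ∀ I, Φ I ↔ I ≠ ⊥ ∧ ∃ p ∈ T, p.asIdeal = I) : quasiDim Φ = heightSup T := by
  apply le_antisymm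
  · refine iSup₂_le fun n ⟨c, hc, hc0, hcΦ⟩ => ?_
    have hmem (i) : ∃ p ∈ T, p.asIdeal = c i := by
      rcases eq_or_ne i 0 with rfl | hi
      · exact ⟨⊥, hbot, by rw [hc0, PrimeSpectrum.asIdeal_bot]⟩
      · exact ((hΦ _).1 (hcΦ i hi)).2
    choose f hfT hf using hmem
    let l : LTSeries (PrimeSpectrum A) := LTSeries.mk n f fun i j hij => by
      change (f i).asIdeal < (f j).asIdeal
      rw [hf, hf]
      exact hc hij
    exact le_iSup₂_of_le (f (Fin.last n)) (hfT _) (Order.length_le_height_last (p := l))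
  · refine iSup₂_le fun q hq => Order.height_le fun l hl => ?_
    have hbl {i} (hi : i ≠ 0) : ⊥ < (l i).asIdeal :=
      bot_le.trans_lt (show (l 0).asIdeal < (l i).asIdeal from
        l.strictMono (Fin.pos_iff_ne_zero.2 hi))
    refine le_iSup₂_of_le (f := fun (n : ℕ) (_ : DimChainFor Φ n) => (n : ℕ∞)) l.length
      ⟨fun i => if i = 0 then ⊥ else (l i).asIdeal, fun i j hij => ?_, if_pos rfl,
        fun i hi => ?_⟩ le_rfl
    · have hj : j ≠ 0 := ((Fin.zero_le i).trans_lt hij).ne'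
      simp only [if_neg hj]
      split_ifs
      · exact hbl hj
      · exact l.strictMono hij
    · simp only [if_neg hi, hΦ]
      refine ⟨(hbl hi).ne', l i, hT ?_ hq, rfl⟩
      rw [← hl]
      exact l.monotone (Fin.le_last i)

namespace SemistarOp

variable {R F : Type*} [CommRing R] [Field F] [Algebra R F] (s : SemistarOp R F)

/-- The primes of `R` that are zero or have a proper `⋆_f`-closure. -/
def quasiSpec : Set (PrimeSpectrum R) :=
  {p | p.asIdeal = ⊥ ∨ s.ft (idealExt p.asIdeal) ≠ s.star (idealExt (⊤ : Ideal R))}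

/-- The primes of `R[X₁,…,Xₙ]` whose contraction to `R` lies in `quasiSpec`. -/
def polyQuasiSpec (n : ℕ) : Set (PrimeSpectrum (MvPolynomial (Fin n) R)) :=
  comap (algebraMap R (MvPolynomial (Fin n) R)) ⁻¹' s.quasiSpec

theorem quasiPolyPrime_iff {n : ℕ} {Q : Ideal (MvPolynomial (Fin n) R)} :
    QuasiPolyPrime s n Q ↔ Q ≠ ⊥ ∧ ∃ q ∈ s.polyQuasiSpec n, q.asIdeal = Q := by
  constructor
  · rintro ⟨h0, hQ, h⟩
    exact ⟨h0, ⟨Q, hQ⟩, h, rfl⟩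
  · rintro ⟨h0, q, hq, rfl⟩
    exact ⟨h0, q.2, hq⟩

theorem isLowerSet_quasiSpec [IsFractionRing R F] [Nontrivial R] : IsLowerSet s.quasiSpec := by
  intro p q hqp hp
  refine or_iff_not_imp_left.2 fun hq0 => ?_
  have hp0 : p.asIdeal ≠ ⊥ := ne_bot_of_le_ne_bot hq0 hqp
  have h := hp.resolve_left hp0
  rw [Ne, s.ft_idealExt_eq_iff hp0] at h
  rw [Ne, s.ft_idealExt_eq_iff hq0]
  exact fun h' => h (s.ft_mono (idealExt_mono hqp) h')

theorem isLowerSet_polyQuasiSpec [IsFractionRing R F] [Nontrivial R] (n : ℕ) :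
    IsLowerSet (s.polyQuasiSpec n) :=
  s.isLowerSet_quasiSpec.preimage fun _ _ h => Ideal.comap_mono h

theorem heightSup_polyQuasiSpec_zero :
    heightSup (s.polyQuasiSpec 0) = heightSup s.quasiSpec := by
  rw [← heightSup_preimage (comapEquiv (MvPolynomial.isEmptyAlgEquiv R (Fin 0)).toRingEquiv)]
  congr 1

theorem comap_finSuccLastEquiv_preimage_polyQuasiSpec (n : ℕ) :
    comap (MvPolynomial.finSuccLastEquiv R n).toRingEquiv.toRingHom ⁻¹' s.polyQuasiSpec (n + 1) =
      comap (Polynomial.C : _ →+* Polynomial (MvPolynomial (Fin n) R)) ⁻¹' s.polyQuasiSpec n := by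
  have : (MvPolynomial.finSuccLastEquiv R n).toRingEquiv.toRingHom.comp
      (algebraMap R (MvPolynomial (Fin (n + 1)) R)) =
        Polynomial.C.comp (algebraMap R (MvPolynomial (Fin n) R)) :=
    RingHom.ext fun r => (MvPolynomial.finSuccLastEquiv R n).commutes r
  rw [polyQuasiSpec, polyQuasiSpec, ← Set.preimage_comp, ← Set.preimage_comp]
  congr 1
  funext q
  rw [Function.comp_apply, Function.comp_apply, ← comap_comp_apply, ← comap_comp_apply, this]

variable [IsDomain R]

theorem bot_mem_quasiSpec : ⊥ ∈ s.quasiSpec := Or.inl PrimeSpectrum.asIdeal_bot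

theorem bot_mem_polyQuasiSpec (n : ℕ) : ⊥ ∈ s.polyQuasiSpec n := by
  refine Or.inl ?_
  rw [comap_asIdeal, PrimeSpectrum.asIdeal_bot, ← RingHom.ker_eq_comap_bot,
    RingHom.ker_eq_bot_iff_eq_zero]
  simp [MvPolynomial.algebraMap_eq]

theorem tildeDim_eq_heightSup [IsFractionRing R F] : tildeDim s = heightSup s.quasiSpec := by
  refine quasiDim_eq_heightSup s.isLowerSet_quasiSpec s.bot_mem_quasiSpec fun I => ?_
  rw [s.isQuasiPrime_tilde_iff]
  refine and_congr_right fun h0 => ⟨fun ⟨hI, h⟩ => ⟨⟨I, hI⟩, Or.inr h, rfl⟩, ?_⟩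
  rintro ⟨p, hp, rfl⟩
  exact ⟨p.2, hp.resolve_left h0⟩

theorem polyDim_eq_heightSup [IsFractionRing R F] (n : ℕ) :
    polyDim s n = heightSup (s.polyQuasiSpec n) :=
  quasiDim_eq_heightSup (s.isLowerSet_polyQuasiSpec n) (s.bot_mem_polyQuasiSpec n)
    fun _ => s.quasiPolyPrime_iff

variable {s}

theorem strongOn_polyQuasiSpec [IsFractionRing R F] (hS : TildeStablyStrongSDomain s) (n : ℕ) :
    StrongOn (s.polyQuasiSpec n) := by
  let φ : MvPolynomial (Fin (n + 1)) R →ₐ[R] MvPolynomial (Fin n) R :=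
    MvPolynomial.aeval (Fin.lastCases 0 MvPolynomial.X)
  have hφ : Function.Surjective φ.toRingHom := fun f =>
    ⟨MvPolynomial.rename Fin.castSucc f, by
      change MvPolynomial.aeval _ (MvPolynomial.rename Fin.castSucc f) = f
      rw [MvPolynomial.aeval_rename]
      simp [Function.comp_def]⟩
  have hne (p : PrimeSpectrum (MvPolynomial (Fin n) R)) : (comap φ.toRingHom p).asIdeal ≠ ⊥ := by
    refine (Submodule.ne_bot_iff _).2
      ⟨MvPolynomial.X (Fin.last n), ?_, MvPolynomial.X_ne_zero _⟩
    simp [φ]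
  have hmem {p : PrimeSpectrum (MvPolynomial (Fin n) R)} (hp : p ∈ s.polyQuasiSpec n) :
      comap φ.toRingHom p ∈ s.polyQuasiSpec (n + 1) := by
    rw [polyQuasiSpec, Set.mem_preimage, ← comap_comp_apply]
    exact φ.comp_algebraMap ▸ hp
  refine StrongOn.of_surjective hφ fun p q hq hcov => ?_
  have hp : comap φ.toRingHom p ∈ s.polyQuasiSpec (n + 1) :=
    s.isLowerSet_polyQuasiSpec _ hcov.1.le (hmem hq)
  obtain ⟨-, h₂, -, h₃⟩ := hS (n + 1) n.succ_pos _ _ (s.quasiPolyPrime_iff.2 ⟨hne p, _, hp, rfl⟩)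
    (s.quasiPolyPrime_iff.2 ⟨hne q, _, hmem hq, rfl⟩)
    ⟨hcov.1, fun I hI hlt => hcov.2 (c := ⟨I, hI.2.1⟩) hlt.1 hlt.2⟩
  refine ⟨polyExt_strictMono hcov.1, fun r hr₁ hr₂ => ?_⟩
  let E := (comapEquiv (MvPolynomial.finSuccLastEquiv R (n + 1)).toRingEquiv).symm
  have hE (a : PrimeSpectrum (MvPolynomial (Fin (n + 1)) R)) : (E (polyExt a)).asIdeal =
      a.asIdeal.map (MvPolynomial.rename Fin.castSucc).toRingHom :=
    (MvPolynomial.map_rename_castSucc _).symm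
  have hlt₁ : (E (polyExt (comap φ.toRingHom p))).asIdeal < (E r).asIdeal := E.strictMono hr₁
  have hlt₂ : (E r).asIdeal < (E (polyExt (comap φ.toRingHom q))).asIdeal := E.strictMono hr₂
  obtain ⟨-, t, ht, htE⟩ := s.quasiPolyPrime_iff.1 h₂
  rw [← hE] at htE
  rw [hE] at hlt₁
  refine h₃ (E r).asIdeal (s.quasiPolyPrime_iff.2 ⟨(bot_le.trans_lt hlt₁).ne', _,
    s.isLowerSet_polyQuasiSpec _ (?_ : E r ≤ t) ht, rfl⟩) ⟨hlt₁, hE _ ▸ hlt₂⟩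
  exact (hlt₂.le.trans htE.ge : (E r).asIdeal ≤ t.asIdeal)

theorem heightSup_polyQuasiSpec [IsFractionRing R F] (hS : TildeStablyStrongSDomain s) (n : ℕ) :
    heightSup (s.polyQuasiSpec n) = heightSup s.quasiSpec + n := by
  induction n with
  | zero => simp [s.heightSup_polyQuasiSpec_zero]
  | succ n ih =>
    rw [← heightSup_preimage
      (comapEquiv (MvPolynomial.finSuccLastEquiv R n).toRingEquiv).symm]
    refine (congrArg heightSup (s.comap_finSuccLastEquiv_preimage_polyQuasiSpec n)).trans ?_
    rw [heightSup_comap_C (s.isLowerSet_polyQuasiSpec n) (strongOn_polyQuasiSpec hS n)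
      ⟨⊥, s.bot_mem_polyQuasiSpec n⟩, ih, Nat.cast_add, Nat.cast_one, add_assoc]

end SemistarOp

end Dimension

/-- A `⋆̃`-stably strong S-domain of finite `⋆̃`-dimension is a
`⋆̃`-Jaffard domain. -/
theorem tildeStablyStrongS_isTildeJaffard (D : Type*) [CommRing D] [IsDomain D]
    (s : SemistarOp D (FractionRing D))
    (hS : TildeStablyStrongSDomain s) (hdim : tildeDim s ≠ ⊤) :
    TildeJaffard s := by
  refine ⟨hdim, fun n _ => ?_⟩
  rw [s.polyDim_eq_heightSup, s.tildeDim_eq_heightSup, SemistarOp.heightSup_polyQuasiSpec hS]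
end

section
/- Let ⋆ be a semistar operation on an integral domain D. The following are equivalent: (1) D is a ⋆̃-S-domain; (2) the localization D_P is an S-domain for every quasi-⋆̃-prime ideal P of D; (3) the localization D_M is an S-domain for every quasi-⋆̃-maximal ideal M of D. -/
/- ## Preliminaries: general ideal-chain notions in a commutative ring -/

open Pointwise

section IdealHeight

/-- For a prime ideal the chain-theoretic height is Mathlib's height. -/
theorem idealHeight_eq_height {A : Type*} [CommRing A] (P : Ideal A) [hP : P.IsPrime] :
    idealHeight P = P.height := by
  rw [PrimeSpectrum.height_eq_orderHeight ⟨P, hP⟩, Order.height_eq_iSup_last_eq]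
  apply le_antisymm
  · refine iSup₂_le fun n hn => ?_
    obtain ⟨c, hmono, hprime, hlast⟩ := hn
    let p : LTSeries (PrimeSpectrum A) := LTSeries.mk n (fun i => ⟨c i, hprime i⟩)
      fun _ _ hij => hmono hij
    exact le_iSup₂_of_le p (PrimeSpectrum.ext hlast) le_rfl
  · refine iSup₂_le fun p hp => ?_
    refine le_iSup₂_of_le p.length ⟨fun i => (p i).asIdeal, fun _ _ hij => p.strictMono hij,
      fun i => (p i).isPrime, ?_⟩ le_rfl
    exact congrArg PrimeSpectrum.asIdeal hp

end IdealHeight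

section PolynomialExtension

variable {A : Type*} [CommRing A]

theorem comap_C_map_C (I : Ideal A) :
    (I.map (Polynomial.C : A →+* Polynomial A)).comap Polynomial.C = I := by
  refine le_antisymm (fun x hx => ?_) Ideal.le_comap_map
  simpa using Ideal.mem_map_C_iff.mp (Ideal.mem_comap.mp hx) 0

theorem map_algebraMap_mvPolynomial_eq_comap (I : Ideal A) :
    I.map (algebraMap A (MvPolynomial (Fin 1) A)) =
      (I.map (Polynomial.C : A →+* Polynomial A)).comap
        (MvPolynomial.uniqueAlgEquiv A (Fin 1)).toRingEquiv := by
  rw [← Ideal.map_symm]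
  refine Eq.trans ?_ (Ideal.map_map (Polynomial.C : A →+* Polynomial A)
    (MvPolynomial.uniqueAlgEquiv A (Fin 1)).toRingEquiv.symm.toRingHom).symm
  congr 1
  ext1 x
  exact ((MvPolynomial.uniqueAlgEquiv A (Fin 1)).symm.commutes x).symm

theorem comap_map_algebraMap_mvPolynomial (I : Ideal A) :
    (I.map (algebraMap A (MvPolynomial (Fin 1) A))).comap
      (algebraMap A (MvPolynomial (Fin 1) A)) = I := by
  rw [map_algebraMap_mvPolynomial_eq_comap]
  conv_rhs => rw [← comap_C_map_C I]
  ext x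
  have h : (MvPolynomial.uniqueAlgEquiv A (Fin 1)).toRingEquiv
      (algebraMap A (MvPolynomial (Fin 1) A) x) = Polynomial.C x :=
    (MvPolynomial.uniqueAlgEquiv A (Fin 1)).commutes x
  simp only [Ideal.mem_comap, h]

theorem isPrime_map_algebraMap_mvPolynomial (P : Ideal A) [P.IsPrime] :
    (P.map (algebraMap A (MvPolynomial (Fin 1) A))).IsPrime := by
  have := Ideal.isPrime_map_C_of_isPrime (P := P)
  rw [map_algebraMap_mvPolynomial_eq_comap]
  infer_instance

theorem height_map_algebraMap_mvPolynomial (I : Ideal A) :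
    (I.map (algebraMap A (MvPolynomial (Fin 1) A))).height =
      (I.map (Polynomial.C : A →+* Polynomial A)).height := by
  rw [map_algebraMap_mvPolynomial_eq_comap, RingEquiv.height_comap]

attribute [local instance] Polynomial.algebra Polynomial.isLocalization in
/-- The height of the polynomial extension of a prime is unchanged by localization. -/
theorem height_map_C_map_of_disjoint (S : Submonoid A) {B : Type*} [CommRing B] [Algebra A B]
    [IsLocalization S B] (p : Ideal A) [p.IsPrime]
    (h : Disjoint (S : Set A) (p : Set A)) :
    ((p.map (algebraMap A B)).map (Polynomial.C : B →+* Polynomial B)).height =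
      (p.map (Polynomial.C : A →+* Polynomial A)).height := by
  have := Ideal.isPrime_map_C_of_isPrime (P := p)
  have hdisj : Disjoint ((S.map (Polynomial.C : A →+* Polynomial A) : Submonoid (Polynomial A)) :
      Set (Polynomial A)) (p.map (Polynomial.C : A →+* Polynomial A) : Set (Polynomial A)) := by
    refine Set.disjoint_left.mpr ?_
    rintro _ ⟨b, hb, rfl⟩ ha
    refine Set.disjoint_left.mp h hb ?_
    rw [← comap_C_map_C p]
    exact ha
  rw [← IsLocalization.height_map_of_disjoint (S := Polynomial B) _ _ hdisj, Ideal.map_map,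
    Ideal.map_map]
  congr 2
  ext1 x
  exact (Polynomial.map_C (algebraMap A B)).symm

end PolynomialExtension

/-- `A_P` is an S-domain iff every height-one prime of `A` inside `P` has a height-one
polynomial extension. -/
theorem isSDomain_localization_iff {A : Type*} [CommRing A] (P : Ideal A) [P.IsPrime] :
    IsSDomain (Localization.AtPrime P) ↔
      ∀ p : Ideal A, p.IsPrime → p ≤ P → p.height = 1 →
        (p.map (Polynomial.C : A →+* Polynomial A)).height = 1 := by
  have key (p : Ideal A) (hle : p ≤ P) : Disjoint (P.primeCompl : Set A) (p : Set A) :=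
    Set.disjoint_left.mpr fun _ hx hxp => hx (hle hxp)
  constructor
  · intro h p hp hle hht
    have hq := IsLocalization.isPrime_of_isPrime_disjoint P.primeCompl
      (Localization.AtPrime P) p hp (key p hle)
    have := Ideal.isPrime_map_C_of_isPrime
      (P := p.map (algebraMap A (Localization.AtPrime P)))
    have h1 := h _ hq
    rw [idealHeight_eq_height, idealHeight_eq_height,
      IsLocalization.height_map_of_disjoint P.primeCompl p (key p hle),
      height_map_C_map_of_disjoint P.primeCompl p (key p hle)] at h1
    exact h1 hht
  · intro h Q hQ hht
    have := Ideal.isPrime_map_C_of_isPrime (P := Q)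
    obtain ⟨hp, hdisj⟩ := (IsLocalization.isPrime_iff_isPrime_disjoint P.primeCompl
      (Localization.AtPrime P) Q).mp hQ
    have hle : Q.under A ≤ P := fun x hx => by
      by_contra hxP
      exact Set.disjoint_left.mp hdisj hxP hx
    rw [idealHeight_eq_height] at hht ⊢
    rw [← IsLocalization.map_under P.primeCompl (Localization.AtPrime P) Q,
      height_map_C_map_of_disjoint P.primeCompl _ hdisj]
    exact h _ hp hle (by rw [IsLocalization.height_under P.primeCompl, hht])

section QuasiPrimes

variable {R F : Type*} [CommRing R] [Field F] [Algebra R F]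

/-- A proper quasi-`⋆̃`-ideal lies in a prime quasi-`⋆_f`-maximal ideal. -/
theorem IsQuasiIdeal.exists_le_isQuasiMax_ft [FaithfulSMul R F] {s : SemistarOp R F}
    {I : Ideal R} (hI : IsQuasiIdeal s.tilde I) (htop : I ≠ ⊤) :
    ∃ M : Ideal R, IsQuasiMax s.ft M ∧ M.IsPrime ∧ I ≤ M := by
  by_contra! hcon
  refine htop ((Ideal.eq_top_iff_one I).mpr ?_)
  rw [← hI.2]
  intro M hM hMp
  obtain ⟨d, hdI, hdM⟩ := SetLike.not_le_iff_exists.mp (hcon M hM hMp)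
  exact ⟨d, hdM, d, hdI, by simp [Algebra.smul_def]⟩

/-- A nonzero prime inside a prime quasi-`⋆_f`-maximal ideal is a quasi-`⋆̃`-ideal. -/
theorem isQuasiIdeal_tilde_of_le [FaithfulSMul R F] {s : SemistarOp R F} {P M : Ideal R}
    [hP : P.IsPrime] (hM : IsQuasiMax s.ft M) (hMp : M.IsPrime) (hle : P ≤ M) (hbot : P ≠ ⊥) :
    IsQuasiIdeal s.tilde P := by
  refine ⟨hbot, le_antisymm (fun x hx => ?_) fun x hx N _ hN => ⟨1, hN.one_notMem, ?_⟩⟩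
  · obtain ⟨d, hd, y, hy, hyx⟩ := hx M hM hMp
    have : y = d * x := FaithfulSMul.algebraMap_injective R F (by
      simpa [Algebra.smul_def] using hyx)
    exact (hP.mem_or_mem (this ▸ hy)).resolve_left fun h => hd (hle h)
  · exact ⟨x, hx, by simp⟩

theorem IsQuasiMax.tilde_of_ft [FaithfulSMul R F] {s : SemistarOp R F} {M : Ideal R}
    [hMp : M.IsPrime] (hM : IsQuasiMax s.ft M) : IsQuasiMax s.tilde M := by
  refine ⟨isQuasiIdeal_tilde_of_le hM hMp le_rfl hM.1.1, hM.2.1, fun J hJ hJtop hMJ => ?_⟩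
  obtain ⟨N, hN, -, hJN⟩ := hJ.exists_le_isQuasiMax_ft hJtop
  have hMN := hM.2.2 N hN.1 hN.2.1 (hMJ.trans hJN)
  exact le_antisymm hMJ (hMN ▸ hJN)

theorem SemistarOp.ft_mono_s2 (s : SemistarOp R F) {E G : Submodule R F} (h : E ≤ G) :
    s.ft E ≤ s.ft G :=
  iSup₂_le fun H hH => le_iSup₂_of_le H ⟨hH.1, hH.2.1, hH.2.2.trans h⟩ le_rfl

theorem ft_idealExt_ne_star_top {s : SemistarOp R F} {P M : Ideal R}
    (hM : IsQuasiMax s.ft M) (hle : P ≤ M) :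
    s.ft (idealExt P) ≠ s.star (idealExt (⊤ : Ideal R)) := by
  intro heq
  have hone : (1 : F) ∈ idealExt (⊤ : Ideal R) := ⟨1, trivial, by simp⟩
  have hne : (idealExt (⊤ : Ideal R) : Submodule R F) ≠ ⊥ := fun h => by
    rw [h] at hone
    exact one_ne_zero ((Submodule.mem_bot R).mp hone)
  have hmem : (1 : F) ∈ s.ft (idealExt P) := heq ▸ s.le_star _ hne hone
  refine hM.2.1 ((Ideal.eq_top_iff_one M).mpr ?_)
  rw [← hM.1.2]
  have hmemM : (1 : F) ∈ s.ft (idealExt M) := s.ft_mono_s2 (Submodule.map_mono hle) hmem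
  simpa [idealCon] using hmemM

/-- For a nonzero prime `P` inside a quasi-`⋆_f`-maximal ideal, `P[X]` is a
quasi-`⋆[1]`-prime. -/
theorem quasiPolyPrime_map {s : SemistarOp R F} {P M : Ideal R} [P.IsPrime]
    (hM : IsQuasiMax s.ft M) (hle : P ≤ M) (hbot : P ≠ ⊥) :
    QuasiPolyPrime s 1 (P.map (algebraMap R (MvPolynomial (Fin 1) R))) := by
  refine ⟨fun h => hbot ?_, isPrime_map_algebraMap_mvPolynomial P, Or.inr ?_⟩
  · exact (Ideal.map_eq_bot_iff_of_injective (MvPolynomial.C_injective (Fin 1) R)).mp h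
  · rw [comap_map_algebraMap_mvPolynomial]
    exact ft_idealExt_ne_star_top hM hle

end QuasiPrimes

/-- `D` is a `⋆̃`-S-domain iff `D_P` is an S-domain for every
quasi-`⋆̃`-prime `P` iff `D_M` is an S-domain for every quasi-`⋆̃`-maximal `M`.
(Quasi-`⋆̃`-maximal ideals are automatically prime; primality is carried as an
instance in order to form the localization.) -/
theorem tildeSDomain_tfae (D : Type*) [CommRing D] [IsDomain D]
    (s : SemistarOp D (FractionRing D)) :
    [TildeSDomain s,
     ∀ (P : Ideal D) [P.IsPrime], IsQuasiIdeal s.tilde P →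
       IsSDomain (Localization.AtPrime P),
     ∀ (M : Ideal D) [M.IsPrime], IsQuasiMax s.tilde M →
       IsSDomain (Localization.AtPrime M)].TFAE := by
  tfae_have 1 → 2 := by
    intro h P hP hPq
    obtain ⟨M, hM, hMp, hPM⟩ := hPq.exists_le_isQuasiMax_ft hP.ne_top
    rw [isSDomain_localization_iff]
    intro p hp hpP hht
    have hbot : p ≠ ⊥ := by
      rintro rfl
      simp at hht
    have := isPrime_map_algebraMap_mvPolynomial p
    have hp1 := (h p ⟨hp, isQuasiIdeal_tilde_of_le hM hMp (hpP.trans hPM) hbot⟩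
      (by rw [idealHeight_eq_height, hht])).2
    rwa [idealHeight_eq_height, height_map_algebraMap_mvPolynomial] at hp1
  tfae_have 2 → 3 := fun h M _ hM => h M hM.1
  tfae_have 3 → 1 := by
    rintro h P ⟨hP, hPq⟩ hht
    obtain ⟨M, hM, hMp, hPM⟩ := hPq.exists_le_isQuasiMax_ft hP.ne_top
    refine ⟨quasiPolyPrime_map hM hPM hPq.1, ?_⟩
    have := isPrime_map_algebraMap_mvPolynomial P
    rw [idealHeight_eq_height] at hht ⊢
    rw [height_map_algebraMap_mvPolynomial]
    exact (isSDomain_localization_iff M).mp (h M hM.tilde_of_ft) P hP hPM hht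
  tfae_finish
end
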